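/- Assume the null hypothesis H₀: Σ¹²(r) = 0 for all r ∈ (0,1], and that Ω = ∫₀¹ (G₂(r) ⊗ G₁(r)) M (G₂(r) ⊗ G₁(r))ᵀ dr is nonsingular. Set δ_T = T^{−1/2} Σ_{t=1}^{T} ϑ_t, Ω̂_w = T^{−1} Σ_{t=1}^{T} (u_{2t} u_{2t}ᵀ) ⊗ (u_{1t} u_{1t}ᵀ), and S_w = δ_Tᵀ Ω̂_w^{−1} δ_T (defined arbitrarily on the event where Ω̂_w is singular, an event whose probability tends to 0). Then, as T → ∞, S_w converges in distribution to the chi-square law with d₁d₂ degrees of freedom, i.e. the law of Σ_{j=1}^{d₁d₂} Z_j² for Z₁, …, Z_{d₁d₂} independent standard normal random variables. -/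

import Mathlib

open MeasureTheory ProbabilityTheory Matrix Filter
open scoped Kronecker NNReal Topology

noncomputable section

/-- A function satisfies a Lipschitz condition piecewise on a finite number of
sub-intervals partitioning `(0,1]`. -/
def PiecewiseLipschitz (f : ℝ → ℝ) : Prop :=
  ∃ (n : ℕ) (a : Fin (n + 1) → ℝ), a 0 = 0 ∧ a (Fin.last n) = 1 ∧ StrictMono a ∧
    ∀ i : Fin n, ∃ K : ℝ≥0, LipschitzOnWith K f (Set.Ioc (a i.castSucc) (a i.succ))

/-- Euclidean norm of a finitely indexed real vector. -/
def euclNorm {ι : Type*} [Fintype ι] (x : ι → ℝ) : ℝ := Real.sqrt (∑ i, x i ^ 2)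

/-- The standard Gaussian measure on `ι → ℝ` (iid standard normal coordinates). -/
def stdGaussianPi (ι : Type*) [Fintype ι] : Measure (ι → ℝ) :=
  Measure.pi fun _ => gaussianReal 0 1

/-- Convergence in distribution (weak convergence of the laws). -/
def TendstoInDistribution {Ω' : Type*} [MeasurableSpace Ω'] (P : Measure Ω')
    {E : Type*} [TopologicalSpace E] [MeasurableSpace E]
    (X : ℕ → Ω' → E) (μ : Measure E) : Prop :=
  ∀ f : BoundedContinuousFunction E ℝ,
    Tendsto (fun T => ∫ ω, f (X T ω) ∂P) atTop (𝓝 (∫ x, f x ∂μ))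

/-- `u_{kt} = G_k(t/T) ε_t`. -/
def uVec {k d : ℕ} (G : ℝ → Matrix (Fin k) (Fin d) ℝ) {Ω' : Type*}
    (ε : ℕ → Ω' → Fin d → ℝ) (T t : ℕ) (ω : Ω') : Fin k → ℝ :=
  (G ((t : ℝ) / T)).mulVec (ε t ω)

/-- `ϑ_t = u_{2t} ⊗ u_{1t}`. -/
def thetaSeq {d₁ d₂ : ℕ} (G₁ : ℝ → Matrix (Fin d₁) (Fin (d₁ + d₂)) ℝ)
    (G₂ : ℝ → Matrix (Fin d₂) (Fin (d₁ + d₂)) ℝ) {Ω' : Type*}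
    (ε : ℕ → Ω' → Fin (d₁ + d₂) → ℝ) (T t : ℕ) (ω : Ω') : Fin d₂ × Fin d₁ → ℝ :=
  fun p => uVec G₂ ε T t ω p.1 * uVec G₁ ε T t ω p.2

/-- `δ_T = T^{-1/2} Σ_{t=1}^T ϑ_t`. -/
def deltaStat {d₁ d₂ : ℕ} (G₁ : ℝ → Matrix (Fin d₁) (Fin (d₁ + d₂)) ℝ)
    (G₂ : ℝ → Matrix (Fin d₂) (Fin (d₁ + d₂)) ℝ) {Ω' : Type*}
    (ε : ℕ → Ω' → Fin (d₁ + d₂) → ℝ) (T : ℕ) (ω : Ω') : Fin d₂ × Fin d₁ → ℝ :=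
  (Real.sqrt T)⁻¹ • ∑ t ∈ Finset.Icc 1 T, thetaSeq G₁ G₂ ε T t ω

/-- `Ω̂_w = T⁻¹ Σ_{t=1}^T (u_{2t} u_{2t}ᵀ) ⊗ (u_{1t} u_{1t}ᵀ)`. -/
def OmHatW {d₁ d₂ : ℕ} (G₁ : ℝ → Matrix (Fin d₁) (Fin (d₁ + d₂)) ℝ)
    (G₂ : ℝ → Matrix (Fin d₂) (Fin (d₁ + d₂)) ℝ) {Ω' : Type*}
    (ε : ℕ → Ω' → Fin (d₁ + d₂) → ℝ) (T : ℕ) (ω : Ω') :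
    Matrix (Fin d₂ × Fin d₁) (Fin d₂ × Fin d₁) ℝ :=
  (T : ℝ)⁻¹ • ∑ t ∈ Finset.Icc 1 T,
    vecMulVec (uVec G₂ ε T t ω) (uVec G₂ ε T t ω) ⊗ₖ
      vecMulVec (uVec G₁ ε T t ω) (uVec G₁ ε T t ω)

/-- The White-corrected Wald statistic `S_w = δ_Tᵀ Ω̂_w⁻¹ δ_T` (with the junk value
of the Lean matrix inverse on the event where `Ω̂_w` is singular). -/
def Sw {d₁ d₂ : ℕ} (G₁ : ℝ → Matrix (Fin d₁) (Fin (d₁ + d₂)) ℝ)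
    (G₂ : ℝ → Matrix (Fin d₂) (Fin (d₁ + d₂)) ℝ) {Ω' : Type*}
    (ε : ℕ → Ω' → Fin (d₁ + d₂) → ℝ) (T : ℕ) (ω : Ω') : ℝ :=
  deltaStat G₁ G₂ ε T ω ⬝ᵥ (OmHatW G₁ G₂ ε T ω)⁻¹.mulVec (deltaStat G₁ G₂ ε T ω)

section helpers

lemma aux_taylor (x : ℝ) :
    ‖Complex.exp (x * Complex.I) - (1 + x * Complex.I - (x:ℂ) ^ 2 / 2)‖ ≤ 4 * |x| ^ 3 := by
  have hn : ‖(x : ℂ) * Complex.I‖ = |x| := by simp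
  rcases le_or_gt |x| 1 with h | h
  · have := Complex.exp_bound (x := (x : ℂ) * Complex.I) (by rw [hn]; exact h) (n := 3) (by norm_num)
    rw [hn] at this
    simp only [Finset.sum_range_succ, Finset.sum_range_zero, Nat.factorial] at this
    have e : (1 + x * Complex.I - (x:ℂ) ^ 2 / 2) = 0 + (↑x * Complex.I) ^ 0 / ((1:ℕ):ℂ) +
        (↑x * Complex.I) ^ 1 / (((0 + 1) * 1 : ℕ):ℂ) +
        (↑x * Complex.I) ^ 2 / (((1 + 1) * ((0 + 1) * 1) : ℕ) : ℂ) := by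
      push_cast
      have := Complex.I_sq
      linear_combination (-(x:ℂ)^2/2) * this
    rw [e]
    refine this.trans ?_
    have : 0 ≤ |x| ^ 3 := by positivity
    norm_num
    linarith
  · have h1 : ‖Complex.exp (x * Complex.I)‖ = 1 := Complex.norm_exp_ofReal_mul_I x
    have h2 : ‖(1 + x * Complex.I - (x:ℂ) ^ 2 / 2)‖ ≤ 1 + |x| + |x| ^ 2 / 2 := by
      refine (norm_sub_le _ _).trans ?_
      refine add_le_add ((norm_add_le _ _).trans ?_) ?_
      · simp
      · simp
    refine (norm_sub_le _ _).trans ?_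
    nlinarith [pow_pos (by linarith : 0 < |x|) 2]

lemma aux_exp_neg (s : ℝ) (hs : 0 ≤ s) : |Real.exp (-s / 2) - (1 - s / 2)| ≤ s ^ 2 := by
  have h1 := Real.add_one_le_exp (-s / 2)
  rw [abs_of_nonneg (by linarith)]
  rcases le_or_gt s 2 with h | h
  · have := Real.abs_exp_sub_one_sub_id_le (x := -s / 2) (by rw [abs_le]; constructor <;> linarith)
    have := (abs_le.1 this).2
    nlinarith [sq_nonneg s]
  · have : Real.exp (-s / 2) ≤ 1 := Real.exp_le_one_iff.2 (by linarith)
    nlinarith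

variable {Ω' : Type*} {mΩ : MeasurableSpace Ω'} {P : Measure Ω'} [IsProbabilityMeasure P]

lemma aux_pullout {E : Type*} [NormedAddCommGroup E] [NormedSpace ℝ E] [CompleteSpace E]
    {m : MeasurableSpace Ω'} (hm : m ≤ mΩ) {Y : Ω' → E} (hY : StronglyMeasurable[m] Y)
    {Z : Ω' → ℝ} {c : ℝ} (hZ : Integrable Z P) (hYZ : Integrable (fun ω => Z ω • Y ω) P)
    (h : P[Z|m] =ᵐ[P] fun _ => c) : ∫ ω, Z ω • Y ω ∂P = c • ∫ ω, Y ω ∂P := by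
  have h1 := condExp_smul_of_aestronglyMeasurable_right (m := m) hZ hYZ hY.aestronglyMeasurable
  have h2 : ∫ ω, (P[fun ω => Z ω • Y ω|m]) ω ∂P = ∫ ω, Z ω • Y ω ∂P := integral_condExp hm
  rw [← h2, ← integral_smul]
  refine integral_congr_ae ?_
  filter_upwards [h1, h] with ω h1 h
  have : (P[fun ω => Z ω • Y ω|m]) ω = (P[Z • Y|m]) ω := rfl
  rw [this, h1]
  simp [h]

lemma aux_integrable_of_cube {X : Ω' → ℝ} (hX : Measurable X) (h : Integrable (fun ω => |X ω| ^ 3) P) :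
    Integrable X P ∧ Integrable (fun ω => X ω ^ 2) P := by
  have h1 := (integrable_const (1:ℝ)).add h
  constructor
  · refine h1.mono' hX.aestronglyMeasurable (Eventually.of_forall fun ω => ?_)
    simp only [Pi.add_apply, Real.norm_eq_abs]
    have := abs_nonneg (X ω)
    rcases le_or_gt |X ω| 1 with h | h
    · nlinarith [pow_nonneg this 3]
    · have := pow_le_pow_right₀ h.le (show 1 ≤ 3 by norm_num)
      linarith
  · refine h1.mono' (hX.pow_const 2).aestronglyMeasurable (Eventually.of_forall fun ω => ?_)
    simp only [Pi.add_apply, Real.norm_eq_abs]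
    have := abs_nonneg (X ω)
    rw [abs_pow]
    rcases le_or_gt |X ω| 1 with h | h
    · nlinarith [pow_nonneg this 3]
    · have := pow_le_pow_right₀ h.le (show 2 ≤ 3 by norm_num)
      linarith

lemma aux_cf_bound (F : Filtration ℕ mΩ) (X : ℕ → Ω' → ℝ) (s : ℕ → ℝ)
    (hX : ∀ t, Measurable[F (t+1)] (X t)) (n : ℕ)
    (h3 : ∀ t < n, Integrable (fun ω => |X t ω| ^ 3) P)
    (h1 : ∀ t < n, P[X t|F t] =ᵐ[P] fun _ => (0:ℝ))
    (h2 : ∀ t < n, P[fun ω => X t ω ^ 2|F t] =ᵐ[P] fun _ => s t)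
    (hs : ∀ t < n, 0 ≤ s t) :
    ‖∫ ω, Complex.exp ((∑ t ∈ Finset.range n, X t ω : ℝ) * Complex.I) ∂P
      - (Real.exp (-(∑ t ∈ Finset.range n, s t) / 2) : ℂ)‖ ≤
      ∑ t ∈ Finset.range n, (4 * ∫ ω, |X t ω| ^ 3 ∂P + s t ^ 2) := by
  induction n with
  | zero => simp
  | succ n ih =>
    have ih := ih (fun t ht => h3 t (by omega)) (fun t ht => h1 t (by omega))
      (fun t ht => h2 t (by omega)) (fun t ht => hs t (by omega))
    set Y : Ω' → ℂ := fun ω => Complex.exp ((∑ t ∈ Finset.range n, X t ω : ℝ) * Complex.I) with hYdef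
    have hYm' : Measurable[F n] fun ω => (∑ t ∈ Finset.range n, X t ω : ℝ) := by
      refine Finset.measurable_sum _ fun t ht => ?_
      exact (hX t).mono (F.mono (by simp at ht; omega)) le_rfl
    have hYm : StronglyMeasurable[F n] Y := by
      refine Measurable.stronglyMeasurable ?_
      exact Complex.measurable_exp.comp ((Complex.measurable_ofReal.comp hYm').mul_const _)
    have hYm0 : Measurable Y := hYm.measurable.mono (F.le n) le_rfl
    have hY1 : ∀ ω, ‖Y ω‖ = 1 := fun ω => Complex.norm_exp_ofReal_mul_I _
    have hXn : Measurable (X n) := (hX n).mono (F.le _) le_rfl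
    obtain ⟨i1, i2⟩ := aux_integrable_of_cube hXn (h3 n (by omega))
    have hYi : Integrable Y P := by
      refine (integrable_const (1:ℝ)).mono' hYm0.aestronglyMeasurable (Eventually.of_forall fun ω => ?_)
      rw [hY1]
    have j1 : Integrable (fun ω => X n ω • Y ω) P := by
      refine i1.norm.mono' (hXn.smul hYm0).aestronglyMeasurable (Eventually.of_forall fun ω => ?_)
      rw [norm_smul, hY1, mul_one]
    have j2 : Integrable (fun ω => (X n ω ^ 2) • Y ω) P := by
      refine i2.norm.mono' ((hXn.pow_const 2).smul hYm0).aestronglyMeasurable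
        (Eventually.of_forall fun ω => ?_)
      rw [norm_smul, hY1, mul_one]
    have k1 := aux_pullout (F.le n) hYm i1 j1 (h1 n (by omega))
    have k2 := aux_pullout (F.le n) hYm i2 j2 (h2 n (by omega))
    set φ := ∫ ω, Y ω ∂P with hφ
    have hφ1 : ‖φ‖ ≤ 1 := by
      refine (norm_integral_le_integral_norm _).trans ?_
      simp [hY1]
    have eY : ∀ ω, Complex.exp ((∑ t ∈ Finset.range (n+1), X t ω : ℝ) * Complex.I)
        = Y ω * Complex.exp (X n ω * Complex.I) := by
      intro ω
      rw [Finset.sum_range_succ, hYdef, ← Complex.exp_add]; push_cast; ring_nf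
    have iexp : Integrable (fun ω => Y ω * Complex.exp (X n ω * Complex.I)) P := by
      refine (integrable_const (1:ℝ)).mono' (hYm0.mul (by fun_prop)).aestronglyMeasurable
        (Eventually.of_forall fun ω => ?_)
      rw [norm_mul, hY1, Complex.norm_exp_ofReal_mul_I]; simp
    have main : ∫ ω, Y ω * (1 + X n ω * Complex.I - (X n ω:ℂ) ^ 2 / 2) ∂P = (1 - s n / 2) * φ := by
      have : ∀ ω, Y ω * (1 + X n ω * Complex.I - (X n ω:ℂ) ^ 2 / 2) =
        Y ω + Complex.I * (X n ω • Y ω) - (1/2) * ((X n ω ^ 2) • Y ω) := by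
        intro ω; simp only [Complex.real_smul]; push_cast; ring
      simp_rw [this]
      have hadd : Integrable (fun ω => Y ω + Complex.I * (X n ω • Y ω)) P := hYi.add (j1.const_mul _)
      rw [integral_sub hadd (j2.const_mul _), integral_add hYi (j1.const_mul _),
        integral_const_mul, integral_const_mul, k1, k2]
      simp only [Complex.real_smul]
      push_cast; ring
    have ipoly : Integrable (fun ω => Y ω * (1 + X n ω * Complex.I - (X n ω:ℂ) ^ 2 / 2)) P := by
      have : ∀ ω, Y ω * (1 + X n ω * Complex.I - (X n ω:ℂ) ^ 2 / 2) =
        Y ω + Complex.I * (X n ω • Y ω) - (1/2) * ((X n ω ^ 2) • Y ω) := by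
        intro ω; simp only [Complex.real_smul]; push_cast; ring
      simp_rw [this]
      exact (hYi.add (j1.const_mul _)).sub (j2.const_mul _)
    have b1 : ‖∫ ω, Y ω * Complex.exp (X n ω * Complex.I) ∂P - (1 - s n / 2) * φ‖
        ≤ 4 * ∫ ω, |X n ω| ^ 3 ∂P := by
      rw [← main, ← integral_sub iexp ipoly, ← integral_const_mul]
      refine norm_integral_le_of_norm_le ((h3 n (by omega)).const_mul _) (Eventually.of_forall fun ω => ?_)
      rw [← mul_sub, norm_mul, hY1, one_mul]
      exact aux_taylor _
    have b2 : ‖((1 - s n / 2 : ℝ) : ℂ) * φ - (Real.exp (-s n / 2) : ℂ) * φ‖ ≤ s n ^ 2 := by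
      rw [← sub_mul, norm_mul, ← Complex.ofReal_sub, Complex.norm_real, Real.norm_eq_abs, abs_sub_comm]
      have := aux_exp_neg (s n) (hs n (by omega))
      calc _ ≤ (s n)^2 * 1 := mul_le_mul this hφ1 (norm_nonneg _) (by positivity)
        _ = _ := mul_one _
    have b3 : ‖(Real.exp (-s n / 2) : ℂ) * φ - (Real.exp (-(∑ t ∈ Finset.range (n+1), s t) / 2) : ℂ)‖
        ≤ ∑ t ∈ Finset.range n, (4 * ∫ ω, |X t ω| ^ 3 ∂P + s t ^ 2) := by
      have : (Real.exp (-(∑ t ∈ Finset.range (n+1), s t) / 2) : ℂ) =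
        (Real.exp (-s n / 2) : ℂ) * (Real.exp (-(∑ t ∈ Finset.range n, s t) / 2) : ℂ) := by
        rw [← Complex.ofReal_mul, ← Real.exp_add, Finset.sum_range_succ]; ring_nf
      rw [this, ← mul_sub, norm_mul, Complex.norm_real, Real.norm_eq_abs, abs_of_pos (Real.exp_pos _)]
      have he : Real.exp (-s n / 2) ≤ 1 := Real.exp_le_one_iff.2 (by linarith [hs n (by omega)])
      calc _ ≤ 1 * _ := mul_le_mul he ih (norm_nonneg _) zero_le_one
        _ = _ := one_mul _
    simp_rw [eY]
    rw [Finset.sum_range_succ (fun t => 4 * ∫ ω, |X t ω| ^ 3 ∂P + s t ^ 2) n]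
    have tri := norm_add₃_le (a := ∫ ω, Y ω * Complex.exp (X n ω * Complex.I) ∂P - (1 - s n / 2) * φ)
      (b := ((1 - s n / 2 : ℝ) : ℂ) * φ - (Real.exp (-s n / 2) : ℂ) * φ)
      (c := (Real.exp (-s n / 2) : ℂ) * φ - (Real.exp (-(∑ t ∈ Finset.range (n+1), s t) / 2) : ℂ))
    refine le_trans (le_of_eq ?_) (tri.trans (by linarith))
    congr 1
    rw [Complex.ofReal_sub, Complex.ofReal_div]
    simp only [Complex.ofReal_one, Complex.ofReal_ofNat]
    ring

/-- second moment of a martingale-difference sum -/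
lemma aux_l2_sum (F : Filtration ℕ mΩ) (Y : ℕ → Ω' → ℝ) (C : ℝ)
    (hY : ∀ t, Measurable[F (t+1)] (Y t)) (n : ℕ)
    (hL : ∀ t < n, MemLp (Y t) 2 P)
    (h1 : ∀ t < n, P[Y t|F t] =ᵐ[P] fun _ => (0:ℝ))
    (hC : ∀ t < n, ∫ ω, Y t ω ^ 2 ∂P ≤ C) :
    MemLp (fun ω => ∑ t ∈ Finset.range n, Y t ω) 2 P ∧
    ∫ ω, (∑ t ∈ Finset.range n, Y t ω) ^ 2 ∂P ≤ n * C := by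
  induction n with
  | zero => simp
  | succ n ih =>
    obtain ⟨ih1, ih2⟩ := ih (fun t ht => hL t (by omega)) (fun t ht => h1 t (by omega))
      (fun t ht => hC t (by omega))
    have hLn := hL n (by omega)
    simp_rw [Finset.sum_range_succ]
    refine ⟨ih1.add hLn, ?_⟩
    set S : Ω' → ℝ := fun ω => ∑ t ∈ Finset.range n, Y t ω with hS
    have hSm : Measurable[F n] S := by
      refine Finset.measurable_sum _ fun t ht => ?_
      exact (hY t).mono (F.mono (by simp at ht; omega)) le_rfl
    have iYS : Integrable (fun ω => Y n ω • S ω) P := hLn.integrable_mul ih1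
    have k := aux_pullout (F.le n) hSm.stronglyMeasurable (hLn.integrable (by norm_num)) iYS
      (h1 n (by omega))
    rw [zero_smul] at k
    have : ∀ ω, (S ω + Y n ω) ^ 2 = S ω ^ 2 + 2 * (Y n ω • S ω) + Y n ω ^ 2 := by
      intro ω; simp only [smul_eq_mul]; ring
    change ∫ ω, (S ω + Y n ω) ^ 2 ∂P ≤ _
    simp_rw [this]
    have hadd : Integrable (fun ω => S ω ^ 2 + 2 * (Y n ω • S ω)) P :=
      ih1.integrable_sq.add (iYS.const_mul 2)
    rw [integral_add hadd hLn.integrable_sq,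
      integral_add ih1.integrable_sq (iYS.const_mul 2), integral_const_mul, k]
    have := hC n (by omega)
    push_cast
    linarith

end helpers
section helpers2

lemma aux_piecewise {f : ℝ → ℝ} (h : PiecewiseLipschitz f) :
    ∃ s : Set ℝ, s.Finite ∧ ∀ r ∈ Set.Ioc (0:ℝ) 1, r ∉ s → ContinuousAt f r := by
  obtain ⟨n, a, h0, h1, hmono, hl⟩ := h
  refine ⟨Set.range a, Set.finite_range a, fun r hr hrs => ?_⟩
  have hne : ∀ j, a j ≠ r := fun j hj => hrs ⟨j, hj⟩
  have : ∃ i : Fin n, a i.castSucc < r ∧ r < a i.succ := by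
    by_contra hcon
    push Not at hcon
    have : ∀ j : Fin (n+1), a j < r := by
      intro j
      induction j using Fin.induction with
      | zero => rw [h0]; exact hr.1
      | succ i ih => exact lt_of_le_of_ne (hcon i ih) (hne _)
    have := this (Fin.last n)
    rw [h1] at this
    exact absurd hr.2 (not_le.2 this)
  obtain ⟨i, hi1, hi2⟩ := this
  obtain ⟨K, hK⟩ := hl i
  exact hK.continuousOn.continuousAt (Ioc_mem_nhds hi1 hi2)

lemma aux_riemann (f : ℝ → ℝ) (C : ℝ) (hb : ∀ r ∈ Set.Ioc (0:ℝ) 1, |f r| ≤ C)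
    (hc : ∀ᵐ r ∂(volume.restrict (Set.Ioc (0:ℝ) 1)), ContinuousAt f r) :
    Tendsto (fun T : ℕ => (T:ℝ)⁻¹ * ∑ t ∈ Finset.range T, f (((t + 1 : ℕ) : ℝ) / T)) atTop
      (𝓝 (∫ r in Set.Ioc (0:ℝ) 1, f r)) := by
  have key : ∀ T : ℕ, 0 < T → ∫ r in Set.Ioc (0:ℝ) 1, f ((⌈(T:ℝ) * r⌉₊ : ℝ) / T) =
      (T:ℝ)⁻¹ * ∑ t ∈ Finset.range T, f (((t + 1 : ℕ) : ℝ) / T) := by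
    intro T hT
    have hT' : (0:ℝ) < T := by exact_mod_cast hT
    have piece : ∀ t : ℕ, Set.EqOn (fun r : ℝ => f ((⌈(T:ℝ) * r⌉₊ : ℝ) / T))
        (fun _ => f (((t + 1 : ℕ) : ℝ) / T)) (Set.Ioc ((t:ℝ) / T) (((t + 1 : ℕ) : ℝ) / T)) := by
      intro t r hr
      have : ⌈(T:ℝ) * r⌉₊ = t + 1 := by
        rw [Nat.ceil_eq_iff (by omega)]
        have h1 := (div_lt_iff₀ hT').1 hr.1
        have h2 := (le_div_iff₀ hT').1 hr.2
        constructor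
        · simp; linarith
        · linarith
      simp only [this]
    have hle : ∀ t : ℕ, (t:ℝ) / T ≤ ((t + 1 : ℕ) : ℝ) / T := by
      intro t; gcongr; simp
    have := intervalIntegral.sum_integral_adjacent_intervals (μ := volume)
      (f := fun r : ℝ => f ((⌈(T:ℝ) * r⌉₊ : ℝ) / T)) (a := fun t : ℕ => (t:ℝ) / T) (n := T) ?_
    · simp only [Nat.cast_zero, zero_div, div_self hT'.ne'] at this
      rw [← intervalIntegral.integral_of_le zero_le_one, ← this, Finset.mul_sum]
      refine Finset.sum_congr rfl fun t _ => ?_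
      rw [intervalIntegral.integral_of_le (hle t), setIntegral_congr_fun measurableSet_Ioc (piece t)]
      simp only [integral_const, smul_eq_mul]
      congr 1
      rw [measureReal_restrict_apply_univ, Real.volume_real_Ioc_of_le (hle t)]
      push_cast; field_simp; ring
    · intro t _
      rw [intervalIntegrable_iff_integrableOn_Ioc_of_le (hle t)]
      refine IntegrableOn.congr_fun ?_ (piece t).symm measurableSet_Ioc
      exact integrableOn_const (by simp)
  have main : Tendsto (fun T : ℕ => ∫ r in Set.Ioc (0:ℝ) 1, f ((⌈(T:ℝ) * r⌉₊ : ℝ) / T)) atTop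
      (𝓝 (∫ r in Set.Ioc (0:ℝ) 1, f r)) := by
    refine tendsto_integral_filter_of_dominated_convergence (fun _ => C) ?_ ?_ (by simp) ?_
    · refine Eventually.of_forall fun T => Measurable.aestronglyMeasurable ?_
      have : (fun r : ℝ => f ((⌈(T:ℝ) * r⌉₊ : ℝ) / T)) =
        (fun n : ℕ => f ((n:ℝ) / T)) ∘ (fun r : ℝ => ⌈(T:ℝ) * r⌉₊) := rfl
      rw [this]
      exact (measurable_from_nat).comp (Nat.measurable_ceil.comp (measurable_const.mul measurable_id))
    · filter_upwards [eventually_gt_atTop 0] with T hT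
      have hT' : (0:ℝ) < T := by exact_mod_cast hT
      filter_upwards [ae_restrict_mem measurableSet_Ioc] with r hr
      refine hb _ ⟨?_, ?_⟩
      · have : 0 < ⌈(T:ℝ) * r⌉₊ := Nat.ceil_pos.2 (mul_pos hT' hr.1)
        positivity
      · rw [div_le_one hT']
        have : ⌈(T:ℝ) * r⌉₊ ≤ T := Nat.ceil_le.2 (by nlinarith [hr.2])
        exact_mod_cast this
    · filter_upwards [hc, ae_restrict_mem measurableSet_Ioc] with r hcr hr
      refine hcr.tendsto.comp ?_
      have := (tendsto_nat_ceil_mul_div_atTop (R := ℝ) hr.1.le).comp (tendsto_natCast_atTop_atTop (R := ℝ))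
      refine this.congr fun T => ?_
      simp [mul_comm]
  refine main.congr' ?_
  filter_upwards [eventually_gt_atTop 0] with T hT using key T hT

end helpers2
section helpers3

variable {Ω' : Type*} {mΩ : MeasurableSpace Ω'} {P : Measure Ω'} [IsProbabilityMeasure P]

lemma aux_ce_sum {β : Type*} (s : Finset β) {m : MeasurableSpace Ω'} (c b : β → ℝ)
    (f : β → Ω' → ℝ) (hf : ∀ i ∈ s, Integrable (f i) P)
    (h : ∀ i ∈ s, P[f i|m] =ᵐ[P] fun _ => b i) :
    P[fun ω => ∑ i ∈ s, c i * f i ω|m] =ᵐ[P] fun _ => ∑ i ∈ s, c i * b i := by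
  have e : (fun ω => ∑ i ∈ s, c i * f i ω) = ∑ i ∈ s, c i • f i := by
    ext ω; simp [Finset.sum_apply]
  rw [e]
  refine (condExp_finsetSum (fun i hi => (hf i hi).smul (c i)) m).trans ?_
  have h2 : ∀ᵐ ω ∂P, ∀ i ∈ s, (P[c i • f i|m]) ω = c i * b i := by
    rw [Filter.eventually_all_finset]
    intro i hi
    filter_upwards [condExp_smul (μ := P) (c i) (f i) m, h i hi] with ω h1 h2
    rw [h1, Pi.smul_apply, h2, smul_eq_mul]
  filter_upwards [h2] with ω h2
  rw [Finset.sum_apply]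
  exact Finset.sum_congr rfl h2

variable {κ : Type*} [Fintype κ]

lemma aux_ce1 {m : MeasurableSpace Ω'} {η : Ω' → κ → ℝ} {a : κ → ℝ}
    (hi : ∀ k, Integrable (fun ω => η ω k) P)
    (ha : ∀ k, P[fun ω => η ω k|m] =ᵐ[P] fun _ => a k) (w : κ → ℝ) :
    P[fun ω => w ⬝ᵥ η ω|m] =ᵐ[P] fun _ => w ⬝ᵥ a :=
  aux_ce_sum Finset.univ w a (fun k ω => η ω k) (fun k _ => hi k) (fun k _ => ha k)

lemma aux_ce2 {m : MeasurableSpace Ω'} {η : Ω' → κ → ℝ} {M : Matrix κ κ ℝ}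
    (hi : ∀ k l, Integrable (fun ω => η ω k * η ω l) P)
    (hM : ∀ k l, P[fun ω => η ω k * η ω l|m] =ᵐ[P] fun _ => M k l) (v w : κ → ℝ) :
    P[fun ω => (v ⬝ᵥ η ω) * (w ⬝ᵥ η ω)|m] =ᵐ[P] fun _ => v ⬝ᵥ M *ᵥ w := by
  have := aux_ce_sum (P := P) (m := m) (Finset.univ : Finset (κ × κ)) (fun p => v p.1 * w p.2) (fun p => M p.1 p.2)
    (fun p ω => η ω p.1 * η ω p.2) (fun p _ => hi _ _) (fun p _ => hM _ _)
  have e1 : (fun ω => (v ⬝ᵥ η ω) * (w ⬝ᵥ η ω)) =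
    fun ω => ∑ p : κ × κ, v p.1 * w p.2 * (η ω p.1 * η ω p.2) := by
    ext ω
    simp only [dotProduct, Finset.sum_mul_sum, Fintype.sum_prod_type]
    refine Finset.sum_congr rfl fun k _ => Finset.sum_congr rfl fun l _ => by ring
  have e2 : v ⬝ᵥ M *ᵥ w = ∑ p : κ × κ, v p.1 * w p.2 * M p.1 p.2 := by
    simp only [dotProduct, mulVec, Fintype.sum_prod_type, Finset.mul_sum]
    refine Finset.sum_congr rfl fun k _ => Finset.sum_congr rfl fun l _ => by ring
  rw [e1, e2]; exact this

lemma aux_dot_le {w x : κ → ℝ} {b R : ℝ} (hb : 0 ≤ b) (hw : ∀ k, |w k| ≤ b) (hx : ∀ k, |x k| ≤ R) :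
    |w ⬝ᵥ x| ≤ b * (Fintype.card κ * R) := by
  refine (Finset.abs_sum_le_sum_abs _ _).trans ?_
  calc ∑ k, |w k * x k| ≤ ∑ _k : κ, b * R := by
        refine Finset.sum_le_sum fun k _ => ?_
        rw [abs_mul]
        exact mul_le_mul (hw k) (hx k) (abs_nonneg _) hb
    _ = _ := by simp; ring

lemma aux_quad_le {v w : κ → ℝ} {b : ℝ} (M : Matrix κ κ ℝ) (hb : 0 ≤ b) (hv : ∀ k, |v k| ≤ b)
    (hw : ∀ k, |w k| ≤ b) : |v ⬝ᵥ M *ᵥ w| ≤ b ^ 2 * ∑ k, ∑ l, |M k l| := by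
  simp only [dotProduct, mulVec, Finset.mul_sum]
  refine (Finset.abs_sum_le_sum_abs _ _).trans ?_
  refine Finset.sum_le_sum fun k _ => (Finset.abs_sum_le_sum_abs _ _).trans ?_
  refine Finset.sum_le_sum fun l _ => ?_
  rw [abs_mul, abs_mul]
  calc |v k| * (|M k l| * |w l|) ≤ b * (|M k l| * b) := by
        gcongr
        · exact hv k
        · exact hw l
    _ = _ := by ring

/-- moment consequences of a dominating variable `R` with four moments -/
lemma aux_mom {R : Ω' → ℝ} (hR0 : ∀ ω, 0 ≤ R ω) (hRm : Measurable R)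
    (h4 : Integrable (fun ω => R ω ^ 4) P) :
    Integrable R P ∧ Integrable (fun ω => R ω ^ 2) P ∧ Integrable (fun ω => R ω ^ 3) P ∧
    ∫ ω, R ω ^ 3 ∂P ≤ 1 + ∫ ω, R ω ^ 4 ∂P := by
  have h1 : Integrable (fun ω => 1 + R ω ^ 4) P := (integrable_const (1:ℝ)).add h4
  have hle : ∀ n ≤ 4, ∀ ω, R ω ^ n ≤ 1 + R ω ^ 4 := by
    intro n hn ω
    rcases le_or_gt (R ω) 1 with h | h
    · have := pow_le_one₀ (n := n) (hR0 ω) h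
      have := pow_nonneg (hR0 ω) 4
      linarith
    · have := pow_le_pow_right₀ h.le hn
      linarith
  have hi : ∀ n ≤ 4, Integrable (fun ω => R ω ^ n) P := by
    intro n hn
    refine h1.mono' (hRm.pow_const n).aestronglyMeasurable (Eventually.of_forall fun ω => ?_)
    rw [Real.norm_eq_abs, abs_of_nonneg (pow_nonneg (hR0 ω) n)]
    exact hle n hn ω
  refine ⟨by simpa using hi 1 (by norm_num), hi 2 (by norm_num), hi 3 (by norm_num), ?_⟩
  calc ∫ ω, R ω ^ 3 ∂P ≤ ∫ ω, (1 + R ω ^ 4) ∂P :=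
        integral_mono (hi 3 (by norm_num)) h1 (hle 3 (by norm_num))
    _ = _ := by rw [integral_add (integrable_const _) h4]; simp

variable {ι : Type*} [Fintype ι]

lemma aux_clt (F : Filtration ℕ mΩ) (η : ℕ → Ω' → κ → ℝ) (R : ℕ → Ω' → ℝ)
    (hη : ∀ t k, Measurable[F (t+1)] (fun ω => η t ω k))
    (hR0 : ∀ t ω, 0 ≤ R t ω) (hRm : ∀ t, Measurable (R t)) (hηR : ∀ t ω k, |η t ω k| ≤ R t ω)
    (h4 : ∀ t, Integrable (fun ω => R t ω ^ 4) P) (C : ℝ) (hC : ∀ t, ∫ ω, R t ω ^ 4 ∂P ≤ C)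
    (a : κ → ℝ) (M : Matrix κ κ ℝ)
    (ha : ∀ t k, P[fun ω => η t ω k|F t] =ᵐ[P] fun _ => a k)
    (hM : ∀ t k l, P[fun ω => η t ω k * η t ω l|F t] =ᵐ[P] fun _ => M k l)
    (w : ℕ → ℕ → κ → ℝ) (B : ℝ) (hB : 0 ≤ B) (hw : ∀ T, ∀ t < T, ∀ k, |w T t k| ≤ B)
    (hwa : ∀ T, ∀ t < T, w T t ⬝ᵥ a = 0) (v : ℝ)
    (hv : Tendsto (fun T : ℕ => (T:ℝ)⁻¹ * ∑ t ∈ Finset.range T, w T t ⬝ᵥ M *ᵥ w T t) atTop (𝓝 v)) :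
    Tendsto (fun T : ℕ => ∫ ω, Complex.exp
      (((Real.sqrt T)⁻¹ * ∑ t ∈ Finset.range T, w T t ⬝ᵥ η t ω : ℝ) * Complex.I) ∂P) atTop
      (𝓝 (Real.exp (-v / 2) : ℂ)) := by
  have hmom := fun t => aux_mom (hR0 t) (hRm t) (h4 t)
  have hηm : ∀ t k, Measurable (fun ω => η t ω k) := fun t k => (hη t k).mono (F.le _) le_rfl
  have hi1 : ∀ t k, Integrable (fun ω => η t ω k) P := fun t k =>
    (hmom t).1.mono' (hηm t k).aestronglyMeasurable (Eventually.of_forall fun ω => hηR t ω k)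
  have hi2 : ∀ t k l, Integrable (fun ω => η t ω k * η t ω l) P := fun t k l =>
    (hmom t).2.1.mono' ((hηm t k).mul (hηm t l)).aestronglyMeasurable
      (Eventually.of_forall fun ω => by
        rw [Real.norm_eq_abs, abs_mul, pow_two]
        exact mul_le_mul (hηR t ω k) (hηR t ω l) (abs_nonneg _) (hR0 t ω))
  set N : ℝ := (Fintype.card κ : ℝ) with hN
  have hN0 : 0 ≤ N := by positivity
  set Mb : ℝ := ∑ k, ∑ l, |M k l| with hMb
  have hMb0 : 0 ≤ Mb := Finset.sum_nonneg fun _ _ => Finset.sum_nonneg fun _ _ => abs_nonneg _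
  have hsq : ∀ T : ℕ, ((Real.sqrt T)⁻¹) ^ 2 = (T:ℝ)⁻¹ := fun T => by
    rw [inv_pow, Real.sq_sqrt (Nat.cast_nonneg T)]
  have bound : ∀ T : ℕ, ‖∫ ω, Complex.exp
      (((Real.sqrt T)⁻¹ * ∑ t ∈ Finset.range T, w T t ⬝ᵥ η t ω : ℝ) * Complex.I) ∂P -
      (Real.exp (-((T:ℝ)⁻¹ * ∑ t ∈ Finset.range T, w T t ⬝ᵥ M *ᵥ w T t) / 2) : ℂ)‖ ≤
      4 * (B * N) ^ 3 * (1 + C) * (Real.sqrt T)⁻¹ + (B^2 * Mb) ^ 2 * (T:ℝ)⁻¹ := by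
    intro T
    set q : ℝ := (Real.sqrt T)⁻¹ with hq
    have hq0 : 0 ≤ q := by positivity
    have hXeq : ∀ t ω, (q • w T t) ⬝ᵥ η t ω = q * (w T t ⬝ᵥ η t ω) := fun t ω => by
      rw [smul_dotProduct, smul_eq_mul]
    have hXm : ∀ t, Measurable[F (t+1)] (fun ω => (q • w T t) ⬝ᵥ η t ω) := by
      intro t
      exact Finset.measurable_sum _ fun k _ => (hη t k).const_mul _
    have hqw : ∀ t < T, ∀ k, |(q • w T t) k| ≤ q * B := by
      intro t ht k
      rw [Pi.smul_apply, smul_eq_mul, abs_mul, abs_of_nonneg hq0]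
      exact mul_le_mul_of_nonneg_left (hw T t ht k) hq0
    have hXb : ∀ t < T, ∀ ω, |(q • w T t) ⬝ᵥ η t ω| ^ 3 ≤ (q * B * N) ^ 3 * R t ω ^ 3 := by
      intro t ht ω
      have := aux_dot_le (by positivity) (hqw t ht) (hηR t ω)
      calc _ ≤ (q * B * (N * R t ω)) ^ 3 := pow_le_pow_left₀ (abs_nonneg _) this 3
        _ = _ := by ring
    have hX3 : ∀ t < T, Integrable (fun ω => |(q • w T t) ⬝ᵥ η t ω| ^ 3) P := by
      intro t ht
      refine ((hmom t).2.2.1.const_mul ((q * B * N) ^ 3)).mono' ?_ (Eventually.of_forall fun ω => ?_)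
      · exact ((((hXm t).mono (F.le _) le_rfl).norm).pow_const 3).aestronglyMeasurable
      · rw [Real.norm_eq_abs, abs_of_nonneg (by positivity)]
        exact hXb t ht ω
    have c2 : ∀ t < T, P[fun ω => ((q • w T t) ⬝ᵥ η t ω) ^ 2|F t] =ᵐ[P]
        fun _ => (q • w T t) ⬝ᵥ M *ᵥ (q • w T t) := by
      intro t ht
      simp_rw [pow_two]
      exact aux_ce2 (hi2 t) (hM t) _ _
    have hs0 : ∀ t < T, 0 ≤ (q • w T t) ⬝ᵥ M *ᵥ (q • w T t) := by
      intro t ht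
      have h1 : ∫ ω, (P[fun ω => ((q • w T t) ⬝ᵥ η t ω) ^ 2|F t]) ω ∂P =
        ∫ ω, ((q • w T t) ⬝ᵥ η t ω) ^ 2 ∂P := integral_condExp (F.le t)
      rw [integral_congr_ae (c2 t ht)] at h1
      simp only [integral_const, probReal_univ, smul_eq_mul, one_mul] at h1
      rw [h1]
      exact integral_nonneg fun ω => sq_nonneg _
    have := aux_cf_bound (P := P) F (fun t ω => (q • w T t) ⬝ᵥ η t ω)
      (fun t => (q • w T t) ⬝ᵥ M *ᵥ (q • w T t)) hXm T hX3
      (fun t ht => by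
        refine (aux_ce1 (hi1 t) (ha t) (q • w T t)).trans ?_
        rw [smul_dotProduct, hwa T t ht, smul_zero]) c2 hs0
    have e1 : ∀ ω, ∑ t ∈ Finset.range T, (q • w T t) ⬝ᵥ η t ω =
        q * ∑ t ∈ Finset.range T, w T t ⬝ᵥ η t ω := fun ω => by
      rw [Finset.mul_sum]; exact Finset.sum_congr rfl fun t _ => hXeq t ω
    have e2 : ∑ t ∈ Finset.range T, (q • w T t) ⬝ᵥ M *ᵥ (q • w T t) =
        (T:ℝ)⁻¹ * ∑ t ∈ Finset.range T, w T t ⬝ᵥ M *ᵥ w T t := by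
      rw [Finset.mul_sum]
      refine Finset.sum_congr rfl fun t _ => ?_
      rw [mulVec_smul, smul_dotProduct, dotProduct_smul, smul_eq_mul, smul_eq_mul, ← hsq]
      ring
    simp_rw [e1] at this
    rw [e2] at this
    refine this.trans ?_
    have step : ∀ t ∈ Finset.range T, (4 * ∫ ω, |(q • w T t) ⬝ᵥ η t ω| ^ 3 ∂P +
        ((q • w T t) ⬝ᵥ M *ᵥ (q • w T t)) ^ 2) ≤
        4 * ((q * B * N) ^ 3 * (1 + C)) + ((q * B)^2 * Mb) ^ 2 := by
      intro t ht
      have ht : t < T := by simpa using ht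
      refine add_le_add ?_ ?_
      · refine mul_le_mul_of_nonneg_left ?_ (by norm_num)
        calc _ ≤ ∫ ω, (q * B * N) ^ 3 * R t ω ^ 3 ∂P :=
              integral_mono (hX3 t ht) ((hmom t).2.2.1.const_mul _) (hXb t ht)
          _ ≤ _ := by
            rw [integral_const_mul]
            refine mul_le_mul_of_nonneg_left ?_ (by positivity)
            linarith [(hmom t).2.2.2, hC t]
      · rw [← sq_abs]
        refine pow_le_pow_left₀ (abs_nonneg _) ?_ 2
        exact aux_quad_le M (by positivity) (hqw t ht) (hqw t ht)
    refine (Finset.sum_le_sum step).trans (le_of_eq ?_)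
    rw [Finset.sum_const, Finset.card_range, nsmul_eq_mul]
    rcases Nat.eq_zero_or_pos T with h0 | hpos
    · subst h0; simp [hq]
    · have hT : (T:ℝ) * q ^ 2 = 1 := by
        rw [hsq]; exact mul_inv_cancel₀ (by positivity)
      rw [← hsq T, ← hq]
      linear_combination (4 * (B*N)^3*(1+C) * q + B^4 * Mb^2 * q^2) * hT
  have hsT : Tendsto (fun T : ℕ => (Real.sqrt T)⁻¹) atTop (𝓝 0) :=
    tendsto_inv_atTop_zero.comp (Real.tendsto_sqrt_atTop.comp tendsto_natCast_atTop_atTop)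
  have hT0 : Tendsto (fun T : ℕ => (T:ℝ)⁻¹) atTop (𝓝 0) :=
    tendsto_inv_atTop_zero.comp tendsto_natCast_atTop_atTop
  have hz : Tendsto (fun T : ℕ => 4 * (B * N) ^ 3 * (1 + C) * (Real.sqrt T)⁻¹ +
      (B^2 * Mb) ^ 2 * (T:ℝ)⁻¹) atTop (𝓝 0) := by
    simpa using (hsT.const_mul (4 * (B * N) ^ 3 * (1 + C))).add (hT0.const_mul ((B^2 * Mb) ^ 2))
  have hd := squeeze_zero_norm bound hz
  have hexp : Tendsto (fun T : ℕ =>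
      (Real.exp (-((T:ℝ)⁻¹ * ∑ t ∈ Finset.range T, w T t ⬝ᵥ M *ᵥ w T t) / 2) : ℂ)) atTop
      (𝓝 (Real.exp (-v / 2) : ℂ)) :=
    (Complex.continuous_ofReal.tendsto _).comp
      ((Real.continuous_exp.tendsto _).comp ((hv.neg).div_const 2))
  simpa using hd.add hexp

lemma aux_lln (F : Filtration ℕ mΩ) (η : ℕ → Ω' → κ → ℝ) (R : ℕ → Ω' → ℝ)
    (hη : ∀ t k, Measurable[F (t+1)] (fun ω => η t ω k))
    (hR0 : ∀ t ω, 0 ≤ R t ω) (hRm : ∀ t, Measurable (R t)) (hηR : ∀ t ω k, |η t ω k| ≤ R t ω)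
    (h4 : ∀ t, Integrable (fun ω => R t ω ^ 4) P) (C : ℝ) (hC : ∀ t, ∫ ω, R t ω ^ 4 ∂P ≤ C)
    (M : Matrix κ κ ℝ)
    (hM : ∀ t k l, P[fun ω => η t ω k * η t ω l|F t] =ᵐ[P] fun _ => M k l)
    (w w' : ℕ → ℕ → κ → ℝ) (B : ℝ) (hB : 0 ≤ B) (hw : ∀ T, ∀ t < T, ∀ k, |w T t k| ≤ B)
    (hw' : ∀ T, ∀ t < T, ∀ k, |w' T t k| ≤ B) (v : ℝ)
    (hv : Tendsto (fun T : ℕ => (T:ℝ)⁻¹ * ∑ t ∈ Finset.range T, w T t ⬝ᵥ M *ᵥ w' T t) atTop (𝓝 v)) :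
    TendstoInMeasure P (fun T : ℕ => fun ω =>
      (T:ℝ)⁻¹ * ∑ t ∈ Finset.range T, (w T t ⬝ᵥ η t ω) * (w' T t ⬝ᵥ η t ω)) atTop (fun _ => v) := by
  have hmom := fun t => aux_mom (hR0 t) (hRm t) (h4 t)
  have hηm : ∀ t k, Measurable (fun ω => η t ω k) := fun t k => (hη t k).mono (F.le _) le_rfl
  have hi2 : ∀ t k l, Integrable (fun ω => η t ω k * η t ω l) P := fun t k l =>
    (hmom t).2.1.mono' ((hηm t k).mul (hηm t l)).aestronglyMeasurable
      (Eventually.of_forall fun ω => by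
        rw [Real.norm_eq_abs, abs_mul, pow_two]
        exact mul_le_mul (hηR t ω k) (hηR t ω l) (abs_nonneg _) (hR0 t ω))
  set N : ℝ := (Fintype.card κ : ℝ) with hN
  have hN0 : 0 ≤ N := by positivity
  set Mb : ℝ := ∑ k, ∑ l, |M k l| with hMb
  set Y : ℕ → ℕ → Ω' → ℝ := fun T t ω =>
    (w T t ⬝ᵥ η t ω) * (w' T t ⬝ᵥ η t ω) - w T t ⬝ᵥ M *ᵥ w' T t with hY
  have hlm : ∀ (u : κ → ℝ) t, Measurable[F (t+1)] (fun ω => u ⬝ᵥ η t ω) := by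
    intro u t
    exact Finset.measurable_sum _ fun k _ => (hη t k).const_mul _
  have hYm : ∀ T t, Measurable[F (t+1)] (Y T t) := fun T t =>
    ((hlm _ t).mul (hlm _ t)).sub_const _
  have hprodb : ∀ T, ∀ t < T, ∀ ω, |(w T t ⬝ᵥ η t ω) * (w' T t ⬝ᵥ η t ω)| ≤ (B * N)^2 * R t ω ^ 2 := by
    intro T t ht ω
    rw [abs_mul]
    have h1 := aux_dot_le hB (hw T t ht) (hηR t ω)
    have h2 := aux_dot_le hB (hw' T t ht) (hηR t ω)
    calc _ ≤ (B * (N * R t ω)) * (B * (N * R t ω)) :=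
          mul_le_mul h1 h2 (abs_nonneg _) (by have := hR0 t ω; positivity)
      _ = _ := by ring
  have hYb : ∀ T, ∀ t < T, ∀ ω, |Y T t ω| ^ 2 ≤ 2 * (B * N)^4 * R t ω ^ 4 + 2 * (B ^ 2 * Mb) ^ 2 := by
    intro T t ht ω
    have h1 := hprodb T t ht ω
    have h2 := aux_quad_le M hB (hw T t ht) (hw' T t ht)
    have h3 : |Y T t ω| ≤ (B * N)^2 * R t ω ^ 2 + B ^ 2 * Mb := (abs_sub _ _).trans (add_le_add h1 h2)
    calc |Y T t ω| ^ 2 ≤ ((B * N)^2 * R t ω ^ 2 + B ^ 2 * Mb) ^ 2 :=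
          pow_le_pow_left₀ (abs_nonneg _) h3 2
      _ ≤ _ := by nlinarith [sq_nonneg ((B * N)^2 * R t ω ^ 2 - B ^ 2 * Mb)]
  have hdom : ∀ t, Integrable (fun ω => 2 * (B * N)^4 * R t ω ^ 4 + 2 * (B ^ 2 * Mb) ^ 2) P := fun t =>
    ((h4 t).const_mul _).add (integrable_const _)
  have hYsq : ∀ T, ∀ t < T, Integrable (fun ω => Y T t ω ^ 2) P := by
    intro T t ht
    refine (hdom t).mono' (((hYm T t).mono (F.le _) le_rfl).pow_const 2).aestronglyMeasurable
      (Eventually.of_forall fun ω => ?_)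
    rw [Real.norm_eq_abs, abs_pow]; exact hYb T t ht ω
  have hYL : ∀ T, ∀ t < T, MemLp (Y T t) 2 P := fun T t ht =>
    (memLp_two_iff_integrable_sq ((hYm T t).mono (F.le _) le_rfl).aestronglyMeasurable).2 (hYsq T t ht)
  set D : ℝ := 2 * (B * N)^4 * C + 2 * (B ^ 2 * Mb) ^ 2 with hD
  have hYD : ∀ T, ∀ t < T, ∫ ω, Y T t ω ^ 2 ∂P ≤ D := by
    intro T t ht
    calc _ ≤ ∫ ω, (2 * (B * N)^4 * R t ω ^ 4 + 2 * (B ^ 2 * Mb) ^ 2) ∂P :=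
          integral_mono (hYsq T t ht) (hdom t) (fun ω => by
            have := hYb T t ht ω; rwa [sq_abs] at this)
      _ ≤ D := by
        rw [integral_add ((h4 t).const_mul _) (integrable_const _), integral_const_mul]
        simp only [integral_const, probReal_univ, smul_eq_mul, one_mul]
        have : 2 * (B * N)^4 * ∫ ω, R t ω ^ 4 ∂P ≤ 2 * (B * N)^4 * C :=
          mul_le_mul_of_nonneg_left (hC t) (by positivity)
        linarith
  have hYc : ∀ T, ∀ t < T, P[Y T t|F t] =ᵐ[P] fun _ => (0:ℝ) := by
    intro T t ht
    have hint : Integrable (fun ω => (w T t ⬝ᵥ η t ω) * (w' T t ⬝ᵥ η t ω)) P := by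
      refine ((hmom t).2.1.const_mul ((B * N)^2)).mono' ?_ (Eventually.of_forall (hprodb T t ht))
      exact (((hlm _ t).mul (hlm _ t)).mono (F.le _) le_rfl).aestronglyMeasurable
    have h1 := condExp_sub (μ := P) hint (integrable_const (w T t ⬝ᵥ M *ᵥ w' T t)) (F t)
    have h2 := aux_ce2 (hi2 t) (hM t) (w T t) (w' T t)
    have h3 : P[fun _ : Ω' => w T t ⬝ᵥ M *ᵥ w' T t|F t] = fun _ => w T t ⬝ᵥ M *ᵥ w' T t :=
      condExp_const (F.le t) _
    refine EventuallyEq.trans h1 ?_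
    filter_upwards [h2] with ω h2
    rw [Pi.sub_apply, h2, h3, sub_self]
  have hsum := fun T => aux_l2_sum (P := P) F (Y T) D (hYm T) T (hYL T) (hYc T) (hYD T)
  rw [tendstoInMeasure_iff_measureReal_dist]
  intro e he
  have hev : ∀ᶠ T : ℕ in atTop,
      |(T:ℝ)⁻¹ * ∑ t ∈ Finset.range T, w T t ⬝ᵥ M *ᵥ w' T t - v| < e / 2 := by
    have := (Metric.tendsto_nhds.1 hv) (e/2) (by positivity)
    simpa [Real.dist_eq] using this
  have hT0 : Tendsto (fun T : ℕ => (D / (e/2)^2) * (T:ℝ)⁻¹) atTop (𝓝 0) := by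
    simpa using (tendsto_inv_atTop_zero.comp (tendsto_natCast_atTop_atTop (R := ℝ))).const_mul (D / (e/2)^2)
  refine squeeze_zero' (Eventually.of_forall fun T => measureReal_nonneg) ?_ hT0
  filter_upwards [hev, eventually_gt_atTop 0] with T hT hpos
  have hT' : (0:ℝ) < T := by exact_mod_cast hpos
  set S : Ω' → ℝ := fun ω => ∑ t ∈ Finset.range T, Y T t ω with hS
  have hSe : ∀ ω, ∑ t ∈ Finset.range T, (w T t ⬝ᵥ η t ω) * (w' T t ⬝ᵥ η t ω) =
      S ω + ∑ t ∈ Finset.range T, w T t ⬝ᵥ M *ᵥ w' T t := by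
    intro ω; simp [hS, hY]
  have hsub : {ω | e ≤ dist ((T:ℝ)⁻¹ * ∑ t ∈ Finset.range T, (w T t ⬝ᵥ η t ω) * (w' T t ⬝ᵥ η t ω)) v}
      ⊆ {ω | (T * (e/2))^2 ≤ S ω ^ 2} := by
    intro ω hω
    simp only [Set.mem_setOf_eq, Real.dist_eq, hSe] at hω ⊢
    have h1 : e ≤ |(T:ℝ)⁻¹ * S ω| + |(T:ℝ)⁻¹ * ∑ t ∈ Finset.range T, w T t ⬝ᵥ M *ᵥ w' T t - v| := by
      refine hω.trans (le_trans (le_of_eq ?_) (abs_add_le _ _))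
      congr 1; ring
    have h2 : e / 2 ≤ |(T:ℝ)⁻¹ * S ω| := by linarith
    rw [abs_mul, abs_of_pos (inv_pos.2 hT'), le_inv_mul_iff₀ hT'] at h2
    rw [← sq_abs (S ω)]
    exact pow_le_pow_left₀ (by positivity) h2 2
  refine (measureReal_mono hsub).trans ?_
  have hmk := mul_meas_ge_le_integral_of_nonneg (μ := P) (f := fun ω => S ω ^ 2)
    (Eventually.of_forall fun ω => sq_nonneg _) (hsum T).1.integrable_sq ((T * (e/2))^2)
  have hb := hmk.trans (hsum T).2
  have : (D / (e/2)^2) * (T:ℝ)⁻¹ = (T * D) / (T * (e/2))^2 := by field_simp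
  rw [this, le_div_iff₀ (by positivity)]
  linarith

end helpers3
section helpers4

variable {Ω' : Type*} {mΩ : MeasurableSpace Ω'} {P : Measure Ω'} [IsProbabilityMeasure P]

lemma aux_tim {α E : Type*} [Fintype α] [PseudoMetricSpace E] (X : ℕ → Ω' → α → ℝ) (c : α → ℝ)
    (h : ∀ a, TendstoInMeasure P (fun n ω => X n ω a) atTop (fun _ => c a))
    (g : (α → ℝ) → E) (hg : ContinuousAt g c) :
    TendstoInMeasure P (fun n ω => g (X n ω)) atTop (fun _ => g c) := by
  rw [tendstoInMeasure_iff_measureReal_dist]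
  intro e he
  obtain ⟨δ, hδ, hball⟩ := Metric.continuousAt_iff.1 hg e he
  have hz : Tendsto (fun n => ∑ a, P.real {ω | δ ≤ dist (X n ω a) (c a)}) atTop (𝓝 0) := by
    have := tendsto_finsetSum (Finset.univ : Finset α) fun a _ =>
      (tendstoInMeasure_iff_measureReal_dist.1 (h a)) δ hδ
    simpa using this
  refine squeeze_zero (fun n => measureReal_nonneg) (fun n => ?_) hz
  have hsub : {ω | e ≤ dist (g (X n ω)) (g c)} ⊆ ⋃ a, {ω | δ ≤ dist (X n ω a) (c a)} := by
    intro ω hω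
    by_contra hcon
    simp only [Set.mem_iUnion, Set.mem_ofPred_eq, not_exists, not_le] at hcon hω
    exact absurd (hball ((dist_pi_lt_iff hδ).2 hcon)) (not_lt.2 hω)
  exact (measureReal_mono hsub).trans (measureReal_iUnion_fintype_le _)

variable {κ ι : Type*} [Fintype κ] [Fintype ι] [DecidableEq ι]

def auxInv (A : ι × ι → ℝ) : ι → ι → ℝ := fun i j => (Matrix.of fun i j => A (i, j))⁻¹ i j

lemma auxInv_eq (A : ι × ι → ℝ) : auxInv A = fun i j => (Matrix.of fun i j => A (i, j)).det⁻¹ *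
    (Matrix.of fun i j => A (i, j)).adjugate i j := by
  ext i j
  simp [auxInv, Matrix.inv_def]

lemma aux_cont_of : Continuous (fun A : ι × ι → ℝ => (Matrix.of fun i j => A (i, j) : Matrix ι ι ℝ)) := by
  refine continuous_matrix fun i j => ?_
  exact continuous_apply (i, j)

lemma auxInv_measurable : Measurable (auxInv (ι := ι)) := by
  refine measurable_pi_lambda _ fun i => measurable_pi_lambda _ fun j => ?_
  simp_rw [auxInv_eq]
  have h1 : Continuous (fun A : ι × ι → ℝ => (Matrix.of fun i j => A (i, j) : Matrix ι ι ℝ).det) :=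
    aux_cont_of.matrix_det
  have h2 : Continuous (fun A : ι × ι → ℝ => (Matrix.of fun i j => A (i, j) : Matrix ι ι ℝ).adjugate i j) :=
    aux_cont_of.matrix_adjugate.matrix_elem i j
  exact h1.measurable.inv.mul h2.measurable

lemma auxInv_continuousAt (A : ι × ι → ℝ) (h : (Matrix.of fun i j => A (i, j)).det ≠ 0) :
    ContinuousAt (auxInv (ι := ι)) A := by
  refine continuousAt_pi.2 fun i => continuousAt_pi.2 fun j => ?_
  simp_rw [auxInv_eq]
  have h1 : Continuous (fun A : ι × ι → ℝ => (Matrix.of fun i j => A (i, j) : Matrix ι ι ℝ).det) :=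
    aux_cont_of.matrix_det
  have h2 : Continuous (fun A : ι × ι → ℝ => (Matrix.of fun i j => A (i, j) : Matrix ι ι ℝ).adjugate i j) :=
    aux_cont_of.matrix_adjugate.matrix_elem i j
  exact (h1.continuousAt.inv₀ h).mul h2.continuousAt

open scoped MatrixOrder Matrix.Norms.L2Operator in
lemma aux_whiten (Om : Matrix ι ι ℝ) (h : Om.PosDef) :
    ∃ L : Matrix ι ι ℝ, IsUnit L.det ∧ L * Om * Lᵀ = 1 ∧ L⁻¹ᵀ * Om⁻¹ * L⁻¹ = 1 := by
  obtain ⟨B, hB⟩ : ∃ B : Matrix ι ι ℝ, Om = Bᴴ * B := by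
    obtain ⟨B, hB⟩ := CStarAlgebra.nonneg_iff_eq_star_mul_self.mp h.posSemidef.nonneg
    exact ⟨B, hB⟩
  have hBt : Bᴴ = Bᵀ := by ext i j; simp
  rw [hBt] at hB
  have hdet : IsUnit B.det := by
    have : Om.det ≠ 0 := h.det_pos.ne'
    rw [hB, det_mul, det_transpose] at this
    exact isUnit_iff_ne_zero.2 (left_ne_zero_of_mul this)
  have hdt : IsUnit Bᵀ.det := by rwa [det_transpose]
  refine ⟨Bᵀ⁻¹, ?_, ?_, ?_⟩
  · exact (Matrix.isUnit_nonsing_inv_det _ hdt)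
  · rw [hB, Matrix.transpose_nonsing_inv, Matrix.transpose_transpose, ← Matrix.mul_assoc,
      Matrix.nonsing_inv_mul _ hdt, Matrix.one_mul, Matrix.mul_nonsing_inv _ hdet]
  · rw [Matrix.nonsing_inv_nonsing_inv _ hdt, Matrix.transpose_transpose, hB, Matrix.mul_inv_rev,
      ← Matrix.mul_assoc, Matrix.mul_nonsing_inv _ hdet, Matrix.one_mul,
      Matrix.nonsing_inv_mul _ hdt]

instance aux_prob_pi : IsProbabilityMeasure (stdGaussianPi ι) := by
  unfold stdGaussianPi; infer_instance

theorem aux_main (F : Filtration ℕ mΩ) (η : ℕ → Ω' → κ → ℝ) (R : ℕ → Ω' → ℝ)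
    (hη : ∀ t k, Measurable[F (t+1)] (fun ω => η t ω k))
    (hR0 : ∀ t ω, 0 ≤ R t ω) (hRm : ∀ t, Measurable (R t)) (hηR : ∀ t ω k, |η t ω k| ≤ R t ω)
    (h4 : ∀ t, Integrable (fun ω => R t ω ^ 4) P) (C : ℝ) (hC : ∀ t, ∫ ω, R t ω ^ 4 ∂P ≤ C)
    (a : κ → ℝ) (M : Matrix κ κ ℝ)
    (ha : ∀ t k, P[fun ω => η t ω k|F t] =ᵐ[P] fun _ => a k)
    (hM : ∀ t k l, P[fun ω => η t ω k * η t ω l|F t] =ᵐ[P] fun _ => M k l)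
    (K : ℕ → ℕ → Matrix ι κ ℝ) (B : ℝ) (hB : 0 ≤ B) (hK : ∀ T, ∀ t < T, ∀ i k, |K T t i k| ≤ B)
    (hKa : ∀ T, ∀ t < T, K T t *ᵥ a = 0) (Om : Matrix ι ι ℝ) (hOm : Om.PosDef)
    (hv : ∀ i j, Tendsto (fun T : ℕ => (T:ℝ)⁻¹ * ∑ t ∈ Finset.range T, (K T t * M * (K T t)ᵀ) i j)
      atTop (𝓝 (Om i j)))
    (δ : ℕ → Ω' → ι → ℝ)
    (hδ : ∀ T ω, δ T ω = (Real.sqrt T)⁻¹ • ∑ t ∈ Finset.range T, K T t *ᵥ η t ω)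
    (H : ℕ → Ω' → Matrix ι ι ℝ)
    (hH : ∀ T ω i j, H T ω i j = (T:ℝ)⁻¹ * ∑ t ∈ Finset.range T, (K T t *ᵥ η t ω) i * (K T t *ᵥ η t ω) j)
    (f : BoundedContinuousFunction ℝ ℝ) :
    Tendsto (fun T => ∫ ω, f (δ T ω ⬝ᵥ (H T ω)⁻¹ *ᵥ δ T ω) ∂P) atTop
      (𝓝 (∫ x, f x ∂((stdGaussianPi ι).map fun z => ∑ j, z j ^ 2))) := by
  obtain ⟨L, hLu, hL1, hL2⟩ := aux_whiten Om hOm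
  have hηm : ∀ t k, Measurable (fun ω => η t ω k) := fun t k => (hη t k).mono (F.le _) le_rfl
  have hKη : ∀ T t i, Measurable (fun ω => (K T t *ᵥ η t ω) i) := by
    intro T t i
    exact Finset.measurable_sum _ fun k _ => (hηm t k).const_mul _
  have hδm : ∀ T, Measurable (δ T) := by
    intro T
    refine measurable_pi_lambda _ fun i => ?_
    simp only [hδ, Pi.smul_apply, Finset.sum_apply, smul_eq_mul]
    exact (Finset.measurable_sum _ fun t _ => hKη T t i).const_mul _
  have hHm : ∀ T i j, Measurable (fun ω => H T ω i j) := by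
    intro T i j
    simp only [hH]
    exact (Finset.measurable_sum _ fun t _ => (hKη T t i).mul (hKη T t j)).const_mul _
  -- whitened statistic
  set Y : ℕ → Ω' → EuclideanSpace ℝ ι := fun T ω => WithLp.toLp 2 (L *ᵥ δ T ω) with hY
  have hcontL : Continuous (fun x : ι → ℝ => L *ᵥ x) := by fun_prop
  have hYm : ∀ T, Measurable (Y T) := fun T =>
    (PiLp.continuous_toLp 2 _).measurable.comp (hcontL.measurable.comp (hδm T))
  have hYlim : MeasureTheory.TendstoInDistribution Y atTop
      (fun z : ι → ℝ => (WithLp.toLp 2 z : EuclideanSpace ℝ ι)) (fun _ => P) (stdGaussianPi ι) := by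
    refine ⟨fun T => (hYm T).aemeasurable, (PiLp.continuous_toLp 2 _).measurable.aemeasurable, ?_⟩
    refine ProbabilityMeasure.tendsto_iff_tendsto_charFun.2 fun x => ?_
    simp only [ProbabilityMeasure.coe_mk]
    have e0 : (stdGaussianPi ι).map (fun z : ι → ℝ => (WithLp.toLp 2 z : EuclideanSpace ℝ ι)) =
      stdGaussian (EuclideanSpace ℝ ι) := map_pi_eq_stdGaussian
    rw [e0, charFun_stdGaussian]
    set x' : ι → ℝ := WithLp.ofLp x with hx'
    set y : ι → ℝ := x' ᵥ* L with hy
    have hlim := aux_clt (P := P) F η R hη hR0 hRm hηR h4 C hC a M ha hM (fun T t => y ᵥ* K T t)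
      ((∑ i, |y i|) * B) (mul_nonneg (Finset.sum_nonneg fun _ _ => abs_nonneg _) hB)
      (fun T t ht k => by
        refine (Finset.abs_sum_le_sum_abs _ _).trans ?_
        rw [Finset.sum_mul]
        refine Finset.sum_le_sum fun i _ => ?_
        rw [abs_mul]
        exact mul_le_mul_of_nonneg_left (hK T t ht i k) (abs_nonneg _))
      (fun T t ht => by rw [← dotProduct_mulVec, hKa T t ht, dotProduct_zero])
      (‖x‖ ^ 2) ?_
    · have e1 : ∀ T, charFun (P.map (Y T)) x = ∫ ω, Complex.exp
        (((Real.sqrt T)⁻¹ * ∑ t ∈ Finset.range T, (y ᵥ* K T t) ⬝ᵥ η t ω : ℝ) * Complex.I) ∂P := by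
        intro T
        rw [charFun_apply, integral_map (hYm T).aemeasurable (by fun_prop)]
        refine integral_congr_ae (Eventually.of_forall fun ω => ?_)
        have : inner ℝ (Y T ω) x = (Real.sqrt T)⁻¹ * ∑ t ∈ Finset.range T, (y ᵥ* K T t) ⬝ᵥ η t ω := by
          have : inner ℝ (Y T ω) x = x' ⬝ᵥ (L *ᵥ δ T ω) := by
            rw [EuclideanSpace.inner_eq_star_dotProduct]
            simp [hY, hx']
          rw [this, dotProduct_mulVec, hδ, dotProduct_smul, smul_eq_mul, dotProduct_sum]
          congr 1
          exact Finset.sum_congr rfl fun t _ => dotProduct_mulVec _ _ _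
        simp only [this]
      refine Tendsto.congr (fun T => (e1 T).symm) ?_
      convert hlim using 2
      push_cast
      rfl
    · have e2 : ∀ T t, (y ᵥ* K T t) ⬝ᵥ M *ᵥ (y ᵥ* K T t) =
          ∑ i, ∑ j, y i * y j * (K T t * M * (K T t)ᵀ) i j := by
        intro T t
        have : (y ᵥ* K T t) ⬝ᵥ M *ᵥ (y ᵥ* K T t) = y ⬝ᵥ (K T t * M * (K T t)ᵀ) *ᵥ y := by
          rw [← mulVec_mulVec, ← mulVec_mulVec, mulVec_transpose, dotProduct_mulVec y (K T t)]
        rw [this]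
        simp only [dotProduct, mulVec, Finset.mul_sum]
        exact Finset.sum_congr rfl fun i _ => Finset.sum_congr rfl fun j _ => by ring
      have e3 : ‖x‖ ^ 2 = ∑ i, ∑ j, y i * y j * Om i j := by
        have h1 : ∑ i, ∑ j, y i * y j * Om i j = y ⬝ᵥ Om *ᵥ y := by
          simp only [dotProduct, mulVec, Finset.mul_sum]
          exact Finset.sum_congr rfl fun i _ => Finset.sum_congr rfl fun j _ => by ring
        have h2 : y ⬝ᵥ Om *ᵥ y = x' ⬝ᵥ (L * Om * Lᵀ) *ᵥ x' := by
          rw [← mulVec_mulVec, ← mulVec_mulVec, mulVec_transpose, dotProduct_mulVec x' L]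
        rw [h1, h2, hL1, one_mulVec, EuclideanSpace.real_norm_sq_eq]
        simp [dotProduct, hx', pow_two]
      rw [e3]
      have := tendsto_finsetSum (Finset.univ : Finset ι) fun i _ =>
        tendsto_finsetSum (Finset.univ : Finset ι) fun j _ => (hv i j).const_mul (y i * y j)
      refine this.congr fun T => ?_
      simp only [e2, Finset.mul_sum]
      rw [Finset.sum_comm' (t' := Finset.univ) (s' := fun _ => Finset.range T) (by simp)]
      refine Finset.sum_congr rfl fun i _ => ?_
      rw [Finset.sum_comm' (t' := Finset.univ) (s' := fun _ => Finset.range T) (by simp)]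
      exact Finset.sum_congr rfl fun i _ => Finset.sum_congr rfl fun j _ => by ring
  -- covariance estimator
  have hHlim : TendstoInMeasure P (fun T ω => auxInv (fun p : ι × ι => H T ω p.1 p.2)) atTop
      (fun _ => auxInv (fun p : ι × ι => Om p.1 p.2)) := by
    refine aux_tim (fun T ω (p : ι × ι) => H T ω p.1 p.2) _ (fun p => ?_) _
      (auxInv_continuousAt _ hOm.det_pos.ne')
    simp only [hH]
    refine aux_lln (P := P) F η R hη hR0 hRm hηR h4 C hC M hM (fun T t => K T t p.1)
      (fun T t => K T t p.2) B hB (fun T t ht k => hK T t ht _ k) (fun T t ht k => hK T t ht _ k) _ ?_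
    refine (hv p.1 p.2).congr fun T => ?_
    congr 1
    refine Finset.sum_congr rfl fun t _ => ?_
    rw [Matrix.mul_assoc, Matrix.mul_apply']
    congr 1
  have hg : Continuous (fun q : EuclideanSpace ℝ ι × (ι → ι → ℝ) =>
      (L⁻¹ *ᵥ WithLp.ofLp q.1) ⬝ᵥ (Matrix.of q.2) *ᵥ (L⁻¹ *ᵥ WithLp.ofLp q.1)) := by
    have h1 : Continuous (fun q : EuclideanSpace ℝ ι × (ι → ι → ℝ) => L⁻¹ *ᵥ WithLp.ofLp q.1) :=
      continuous_const.matrix_mulVec ((PiLp.continuous_ofLp 2 _).comp continuous_fst)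
    have h2 : Continuous (fun q : EuclideanSpace ℝ ι × (ι → ι → ℝ) => (Matrix.of q.2 : Matrix ι ι ℝ)) :=
      continuous_snd
    exact h1.dotProduct (h2.matrix_mulVec h1)
  have hfin := hYlim.continuous_comp_prodMk_of_tendstoInMeasure_const hg hHlim
    (fun T => (auxInv_measurable.comp (measurable_pi_lambda _ fun p => hHm T p.1 p.2)).aemeasurable)
  have hS : ∀ T ω, (L⁻¹ *ᵥ WithLp.ofLp (Y T ω)) ⬝ᵥ
      (Matrix.of (auxInv (fun p : ι × ι => H T ω p.1 p.2))) *ᵥ (L⁻¹ *ᵥ WithLp.ofLp (Y T ω)) =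
      δ T ω ⬝ᵥ (H T ω)⁻¹ *ᵥ δ T ω := by
    intro T ω
    have h1 : L⁻¹ *ᵥ WithLp.ofLp (Y T ω) = δ T ω := by
      simp only [hY]
      rw [mulVec_mulVec, Matrix.nonsing_inv_mul _ hLu, one_mulVec]
    rw [h1]
    rfl
  have hZ : ∀ z : ι → ℝ, (L⁻¹ *ᵥ z) ⬝ᵥ
      (Matrix.of (auxInv (fun p : ι × ι => Om p.1 p.2))) *ᵥ (L⁻¹ *ᵥ z) = ∑ j, z j ^ 2 := by
    intro z
    have h1 : (Matrix.of (auxInv (fun p : ι × ι => Om p.1 p.2))) = Om⁻¹ := rfl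
    have h2 : (L⁻¹ *ᵥ z) ⬝ᵥ Om⁻¹ *ᵥ (L⁻¹ *ᵥ z) = z ⬝ᵥ (L⁻¹ᵀ * Om⁻¹ * L⁻¹) *ᵥ z := by
      rw [← mulVec_mulVec, ← mulVec_mulVec, dotProduct_mulVec z L⁻¹ᵀ, vecMul_transpose]
    rw [h1, h2, hL2, one_mulVec]
    simp [dotProduct, pow_two]
  have := (ProbabilityMeasure.tendsto_iff_forall_integral_tendsto.1 hfin.tendsto) f
  simp only [ProbabilityMeasure.coe_mk] at this
  rw [integral_map hfin.aemeasurable_limit f.continuous.aestronglyMeasurable] at this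
  rw [integral_map (Finset.measurable_sum _ fun j _ => (measurable_pi_apply j).pow_const 2).aemeasurable f.continuous.aestronglyMeasurable]
  have e4 : ∀ T, ∫ x, f x ∂(P.map fun ω => (L⁻¹ *ᵥ WithLp.ofLp (Y T ω)) ⬝ᵥ
      (Matrix.of (auxInv (fun p : ι × ι => H T ω p.1 p.2))) *ᵥ (L⁻¹ *ᵥ WithLp.ofLp (Y T ω))) =
      ∫ ω, f (δ T ω ⬝ᵥ (H T ω)⁻¹ *ᵥ δ T ω) ∂P := by
    intro T
    rw [integral_map (hfin.forall_aemeasurable T) f.continuous.aestronglyMeasurable]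
    simp only [hS]
  simp only [hZ] at this
  exact this.congr e4

end helpers4

lemma aux_posdef {ι κ : Type*} [Fintype ι] [DecidableEq ι] [Fintype κ] (M : Matrix κ κ ℝ)
    (hM : M.PosSemidef) (K : ℕ → ℕ → Matrix ι κ ℝ) (Om : Matrix ι ι ℝ)
    (hv : ∀ i j, Tendsto (fun T : ℕ => (T:ℝ)⁻¹ * ∑ t ∈ Finset.range T, (K T t * M * (K T t)ᵀ) i j)
      atTop (𝓝 (Om i j))) (hdet : IsUnit Om.det) : Om.PosDef := by
  have hA : ∀ T t, (K T t * M * (K T t)ᵀ).PosSemidef := fun T t => by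
    have := hM.mul_mul_conjTranspose_same (K T t)
    rwa [Matrix.conjTranspose_eq_transpose_of_trivial] at this
  have hps : Om.PosSemidef := by
    refine Matrix.PosSemidef.of_dotProduct_mulVec_nonneg ?_ fun x => ?_
    · ext i j
      simp only [Matrix.conjTranspose_apply, star_trivial]
      refine tendsto_nhds_unique (hv j i) ((hv i j).congr fun T => ?_)
      congr 1
      refine Finset.sum_congr rfl fun t _ => ?_
      have := (hA T t).1.apply i j
      simpa using this.symm
    · have h : Tendsto (fun T : ℕ => ∑ i, ∑ j, x i * (((T:ℝ)⁻¹ * ∑ t ∈ Finset.range T,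
          (K T t * M * (K T t)ᵀ) i j) * x j)) atTop (𝓝 (star x ⬝ᵥ Om *ᵥ x)) := by
        simp only [dotProduct, mulVec, Finset.mul_sum, star_trivial, Pi.star_apply]
        refine tendsto_finsetSum _ fun i _ => tendsto_finsetSum _ fun j _ => ?_
        have := ((hv i j).mul_const (x j)).const_mul (x i)
        simpa only [Finset.mul_sum] using this
      refine ge_of_tendsto' h fun T => ?_
      have e : ∑ i, ∑ j, x i * (((T:ℝ)⁻¹ * ∑ t ∈ Finset.range T,
          (K T t * M * (K T t)ᵀ) i j) * x j) =
          (T:ℝ)⁻¹ * ∑ t ∈ Finset.range T, star x ⬝ᵥ (K T t * M * (K T t)ᵀ) *ᵥ x := by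
        simp only [dotProduct, mulVec, star_trivial, Pi.star_apply]
        rw [Finset.sum_comm (s := Finset.range T), Finset.mul_sum]
        refine Finset.sum_congr rfl fun i _ => ?_
        simp only [Finset.mul_sum, Finset.sum_mul]
        rw [Finset.sum_comm]
        refine Finset.sum_congr rfl fun t _ => Finset.sum_congr rfl fun j _ => ?_
        ring
      rw [e]
      exact mul_nonneg (by positivity) (Finset.sum_nonneg fun t _ =>
        (hA T t).dotProduct_mulVec_nonneg x)
  exact hps.posDef_iff_det_ne_zero.2 hdet.ne_zero

lemma aux_M {Ω' : Type*} {mΩ : MeasurableSpace Ω'} {P : Measure Ω'} [IsProbabilityMeasure P]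
    {κ : Type*} [Fintype κ] {m : MeasurableSpace Ω'} (hm : m ≤ mΩ) {η : Ω' → κ → ℝ}
    {M : Matrix κ κ ℝ} (hi : ∀ k l, Integrable (fun ω => η ω k * η ω l) P)
    (hM : ∀ k l, P[fun ω => η ω k * η ω l|m] =ᵐ[P] fun _ => M k l) : M.PosSemidef := by
  have key : ∀ v w, v ⬝ᵥ M *ᵥ w = ∫ ω, (v ⬝ᵥ η ω) * (w ⬝ᵥ η ω) ∂P := fun v w => by
    rw [← integral_condExp hm, integral_congr_ae (aux_ce2 hi hM v w)]; simp
  have key2 : ∀ k l, M k l = ∫ ω, η ω k * η ω l ∂P := fun k l => by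
    rw [← integral_condExp hm, integral_congr_ae (hM k l)]; simp
  refine Matrix.PosSemidef.of_dotProduct_mulVec_nonneg ?_ fun x => ?_
  · ext i j
    simp only [Matrix.conjTranspose_apply, star_trivial, key2, mul_comm]
  · rw [star_trivial, key]
    exact integral_nonneg fun ω => mul_self_nonneg _

lemma aux_kron_vec {d a b : ℕ} (A : Matrix (Fin a) (Fin d) ℝ) (B : Matrix (Fin b) (Fin d) ℝ)
    (x : Fin d → ℝ) : (A ⊗ₖ B) *ᵥ (fun k : Fin d × Fin d => x k.1 * x k.2) =
      fun p => (A *ᵥ x) p.1 * (B *ᵥ x) p.2 := by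
  ext p
  simp only [mulVec, dotProduct, Finset.sum_mul_sum, Fintype.sum_prod_type, kroneckerMap_apply]
  refine Finset.sum_congr rfl fun i _ => Finset.sum_congr rfl fun j _ => ?_
  ring

lemma aux_kron_id {d a b : ℕ} (A : Matrix (Fin a) (Fin d) ℝ) (B : Matrix (Fin b) (Fin d) ℝ)
    (h : B * Aᵀ = 0) : (A ⊗ₖ B) *ᵥ (fun k : Fin d × Fin d => if k.1 = k.2 then (1:ℝ) else 0) = 0 := by
  ext p
  have := congrFun (congrFun h p.2) p.1
  simp only [Matrix.mul_apply, transpose_apply, Matrix.zero_apply] at this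
  simp only [mulVec, dotProduct, Fintype.sum_prod_type, kroneckerMap_apply, Pi.zero_apply,
    mul_ite, mul_one, mul_zero, Finset.sum_ite_eq, Finset.mem_univ, if_true]
  refine Eq.trans ?_ this
  exact Finset.sum_congr rfl fun i _ => mul_comm _ _

lemma aux_R {d : ℕ} (x : Fin d → ℝ) (i j : Fin d) : |x i * x j| ≤ ∑ i, x i ^ 2 := by
  have h1 : ∀ i, x i ^ 2 ≤ ∑ i, x i ^ 2 := fun i =>
    Finset.single_le_sum (f := fun i => x i ^ 2) (fun i _ => sq_nonneg _) (Finset.mem_univ i)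
  have := h1 i
  have := h1 j
  rw [abs_le]
  constructor <;> nlinarith [sq_nonneg (x i + x j), sq_nonneg (x i - x j)]

lemma aux_R4 {d : ℕ} (x : Fin d → ℝ) (m : ℝ) (hm : 1 < m) :
    (∑ i, x i ^ 2) ^ 4 ≤ 1 + euclNorm x ^ (8 * m) := by
  have h0 : 0 ≤ euclNorm x := Real.sqrt_nonneg _
  have h2 : euclNorm x ^ 2 = ∑ i, x i ^ 2 :=
    Real.sq_sqrt (Finset.sum_nonneg fun i _ => sq_nonneg _)
  rw [← h2, ← pow_mul]
  have hp : 0 ≤ euclNorm x ^ (8 * m) := Real.rpow_nonneg h0 _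
  rcases le_or_gt (euclNorm x) 1 with h | h
  · have := pow_le_one₀ (n := 2 * 4) h0 h
    linarith
  · have : euclNorm x ^ ((8:ℕ):ℝ) ≤ euclNorm x ^ (8 * m) :=
      Real.rpow_le_rpow_of_exponent_le h.le (by push_cast; linarith)
    rw [Real.rpow_natCast] at this
    norm_num at this ⊢
    linarith
theorem statement8
    (d₁ d₂ : ℕ) (hd₁ : 1 ≤ d₁) (hd₂ : 1 ≤ d₂)
    (G₁ : ℝ → Matrix (Fin d₁) (Fin (d₁ + d₂)) ℝ)
    (G₂ : ℝ → Matrix (Fin d₂) (Fin (d₁ + d₂)) ℝ)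
    (hG₁bdd : ∃ C : ℝ, ∀ r ∈ Set.Ioc (0 : ℝ) 1, ∀ i j, |G₁ r i j| ≤ C)
    (hG₂bdd : ∃ C : ℝ, ∀ r ∈ Set.Ioc (0 : ℝ) 1, ∀ i j, |G₂ r i j| ≤ C)
    (hG₁lip : ∀ i j, PiecewiseLipschitz fun r => G₁ r i j)
    (hG₂lip : ∀ i j, PiecewiseLipschitz fun r => G₂ r i j)
    (hposdef : ∀ r ∈ Set.Ioc (0 : ℝ) 1,
      (Matrix.fromRows (G₁ r) (G₂ r) * (Matrix.fromRows (G₁ r) (G₂ r))ᵀ).PosDef)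
    (hnull : ∀ r ∈ Set.Ioc (0 : ℝ) 1, G₁ r * (G₂ r)ᵀ = 0)
    {Ω' : Type*} {mΩ : MeasurableSpace Ω'} (P : Measure Ω') [IsProbabilityMeasure P]
    (F : Filtration ℕ mΩ)
    (ε : ℕ → Ω' → Fin (d₁ + d₂) → ℝ)
    (hmeas : ∀ t, Measurable (ε t))
    (hadapted : ∀ t, Measurable[F t] (ε t))
    (hcondzero : ∀ t, P[ε (t + 1)|F t] =ᵐ[P] 0)
    (hcondcov : ∀ t i j,
      P[fun ω => ε (t + 1) ω i * ε (t + 1) ω j|F t]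
        =ᵐ[P] fun _ => if i = j then (1 : ℝ) else 0)
    (M : Matrix (Fin (d₁ + d₂) × Fin (d₁ + d₂)) (Fin (d₁ + d₂) × Fin (d₁ + d₂)) ℝ)
    (hcondM : ∀ t, ∀ p q : Fin (d₁ + d₂) × Fin (d₁ + d₂),
      P[fun ω => ε (t + 1) ω p.1 * ε (t + 1) ω q.1 * (ε (t + 1) ω p.2 * ε (t + 1) ω q.2)|F t]
        =ᵐ[P] fun _ => M p q)
    (hmom : ∃ m : ℝ, 1 < m ∧ (∀ t, Integrable (fun ω => euclNorm (ε t ω) ^ (8 * m)) P) ∧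
      ∃ C : ℝ, ∀ t, ∫ ω, euclNorm (ε t ω) ^ (8 * m) ∂P ≤ C)
    (hOmreg : IsUnit (Matrix.of fun p q : Fin d₂ × Fin d₁ =>
      ∫ r in Set.Ioc (0 : ℝ) 1, ((G₂ r ⊗ₖ G₁ r) * M * (G₂ r ⊗ₖ G₁ r)ᵀ) p q).det) :
    TendstoInDistribution P (Sw G₁ G₂ ε)
      ((stdGaussianPi (Fin d₂ × Fin d₁)).map fun z => ∑ j, z j ^ 2) := by
  obtain ⟨C1, hC1⟩ := hG₁bdd
  obtain ⟨C2, hC2⟩ := hG₂bdd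
  obtain ⟨m, hm1, hmi, Cm, hCm⟩ := hmom
  have hmemT : ∀ T t : ℕ, t < T → (((t + 1 : ℕ) : ℝ) / T) ∈ Set.Ioc (0:ℝ) 1 := by
    intro T t ht
    have hT : (0:ℝ) < T := by exact_mod_cast (Nat.zero_le t).trans_lt ht
    refine ⟨by positivity, ?_⟩
    rw [div_le_one hT]
    exact_mod_cast ht
  set B : ℝ := |C2| * |C1| with hBdef
  have hB : 0 ≤ B := by positivity
  have hKr : ∀ r ∈ Set.Ioc (0:ℝ) 1, ∀ p k, |(G₂ r ⊗ₖ G₁ r) p k| ≤ B := by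
    intro r hr p k
    rw [kroneckerMap_apply, abs_mul]
    exact mul_le_mul ((hC2 r hr _ _).trans (le_abs_self _)) ((hC1 r hr _ _).trans (le_abs_self _))
      (abs_nonneg _) (abs_nonneg _)
  set K : ℕ → ℕ → Matrix (Fin d₂ × Fin d₁) (Fin (d₁ + d₂) × Fin (d₁ + d₂)) ℝ := fun T t =>
    G₂ (((t + 1 : ℕ) : ℝ) / T) ⊗ₖ G₁ (((t + 1 : ℕ) : ℝ) / T) with hKdef
  set η : ℕ → Ω' → Fin (d₁ + d₂) × Fin (d₁ + d₂) → ℝ := fun t ω k =>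
    ε (t + 1) ω k.1 * ε (t + 1) ω k.2 with hηdef
  set R : ℕ → Ω' → ℝ := fun t ω => ∑ i, ε (t + 1) ω i ^ 2 with hRdef
  have hεm : ∀ t i, Measurable (fun ω => ε t ω i) := fun t i =>
    (measurable_pi_apply i).comp (hmeas t)
  have hεa : ∀ t i, Measurable[F t] (fun ω => ε t ω i) := fun t i =>
    (measurable_pi_apply i).comp (hadapted t)
  have hη : ∀ t k, Measurable[F (t+1)] (fun ω => η t ω k) := fun t k =>
    (hεa (t+1) k.1).mul (hεa (t+1) k.2)
  have hR0 : ∀ t ω, 0 ≤ R t ω := fun t ω => Finset.sum_nonneg fun i _ => sq_nonneg _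
  have hRm : ∀ t, Measurable (R t) := fun t =>
    Finset.measurable_sum _ fun i _ => (hεm (t+1) i).pow_const 2
  have hηR : ∀ t ω k, |η t ω k| ≤ R t ω := fun t ω k => aux_R _ _ _
  have hi1 : ∀ t, Integrable (fun ω => 1 + euclNorm (ε (t+1) ω) ^ (8 * m)) P := fun t =>
    (integrable_const (1:ℝ)).add (hmi (t+1))
  have h4 : ∀ t, Integrable (fun ω => R t ω ^ 4) P := fun t =>
    (hi1 t).mono' ((hRm t).pow_const 4).aestronglyMeasurable (Eventually.of_forall fun ω => by
      rw [Real.norm_eq_abs, abs_of_nonneg (pow_nonneg (hR0 t ω) 4)]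
      exact aux_R4 _ m hm1)
  have hC4 : ∀ t, ∫ ω, R t ω ^ 4 ∂P ≤ 1 + Cm := fun t => by
    calc ∫ ω, R t ω ^ 4 ∂P ≤ ∫ ω, (1 + euclNorm (ε (t+1) ω) ^ (8 * m)) ∂P :=
          integral_mono (h4 t) (hi1 t) fun ω => aux_R4 _ m hm1
      _ = 1 + ∫ ω, euclNorm (ε (t+1) ω) ^ (8 * m) ∂P := by
          rw [integral_add (integrable_const _) (hmi (t+1))]; simp
      _ ≤ 1 + Cm := by linarith [hCm (t+1)]
  have hM : ∀ t k l, P[fun ω => η t ω k * η t ω l|F t] =ᵐ[P] fun _ => M k l := by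
    intro t k l
    have := hcondM t k l
    have e : (fun ω => η t ω k * η t ω l) = fun ω =>
        ε (t + 1) ω k.1 * ε (t + 1) ω l.1 * (ε (t + 1) ω k.2 * ε (t + 1) ω l.2) := by
      funext ω; simp only [hηdef]; ring
    rw [e]; exact this
  have hMps : M.PosSemidef := by
    refine aux_M (P := P) (F.le 0) (η := η 0) (fun k l => ?_) (hM 0)
    refine (aux_mom (hR0 0) (hRm 0) (h4 0)).2.1.mono'
      (((hη 0 k).mono (F.le _) le_rfl).mul ((hη 0 l).mono (F.le _) le_rfl)).aestronglyMeasurable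
      (Eventually.of_forall fun ω => ?_)
    rw [Real.norm_eq_abs, abs_mul, pow_two]
    exact mul_le_mul (hηR 0 ω k) (hηR 0 ω l) (abs_nonneg _) (hR0 0 ω)
  have hform : ∀ (A : Matrix (Fin d₂ × Fin d₁) (Fin (d₁ + d₂) × Fin (d₁ + d₂)) ℝ) p q,
      (A * M * Aᵀ) p q = (A p) ⬝ᵥ M *ᵥ (A q) := by
    intro A p q
    rw [Matrix.mul_assoc]
    rfl
  set Om : Matrix (Fin d₂ × Fin d₁) (Fin d₂ × Fin d₁) ℝ := Matrix.of fun p q =>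
      ∫ r in Set.Ioc (0 : ℝ) 1, ((G₂ r ⊗ₖ G₁ r) * M * (G₂ r ⊗ₖ G₁ r)ᵀ) p q with hOmdef
  have hv : ∀ i j, Tendsto (fun T : ℕ => (T:ℝ)⁻¹ * ∑ t ∈ Finset.range T,
      (K T t * M * (K T t)ᵀ) i j) atTop (𝓝 (Om i j)) := by
    intro p q
    refine aux_riemann (fun r => ((G₂ r ⊗ₖ G₁ r) * M * (G₂ r ⊗ₖ G₁ r)ᵀ) p q)
      (B ^ 2 * ∑ k, ∑ l, |M k l|) (fun r hr => ?_) ?_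
    · rw [hform]
      exact aux_quad_le M hB (hKr r hr p) (hKr r hr q)
    · choose s1 hs1 hs1c using fun i j => aux_piecewise (hG₁lip i j)
      choose s2 hs2 hs2c using fun i j => aux_piecewise (hG₂lip i j)
      have hfin : ((⋃ i, ⋃ j, s1 i j) ∪ ⋃ i, ⋃ j, s2 i j).Finite :=
        (Set.finite_iUnion fun i => Set.finite_iUnion fun j => hs1 i j).union
          (Set.finite_iUnion fun i => Set.finite_iUnion fun j => hs2 i j)
      have hnot : ∀ᵐ r ∂(volume.restrict (Set.Ioc (0:ℝ) 1)),
          r ∉ ((⋃ i, ⋃ j, s1 i j) ∪ ⋃ i, ⋃ j, s2 i j) :=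
        ae_restrict_of_ae (measure_eq_zero_iff_ae_notMem.1 (hfin.measure_zero volume))
      filter_upwards [hnot, ae_restrict_mem measurableSet_Ioc] with r hr hr1
      have c1 : ∀ i j, ContinuousAt (fun r => G₁ r i j) r := fun i j =>
        hs1c i j r hr1 fun h => hr (Or.inl (Set.mem_iUnion₂.2 ⟨i, j, h⟩))
      have c2 : ∀ i j, ContinuousAt (fun r => G₂ r i j) r := fun i j =>
        hs2c i j r hr1 fun h => hr (Or.inr (Set.mem_iUnion₂.2 ⟨i, j, h⟩))
      have ck : ∀ p k, ContinuousAt (fun r => (G₂ r ⊗ₖ G₁ r) p k) r := fun p k =>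
        (c2 p.1 k.1).mul (c1 p.2 k.2)
      simp only [hform, dotProduct, mulVec]
      exact tendsto_finsetSum _ fun k _ => (ck p k).mul
        (tendsto_finsetSum _ fun l _ => tendsto_const_nhds.mul (ck q l))
  have hOm : Om.PosDef := aux_posdef M hMps K Om hv hOmreg
  have hθ : ∀ T t ω, thetaSeq G₁ G₂ ε T (t + 1) ω = K T t *ᵥ η t ω := by
    intro T t ω
    rw [hKdef, hηdef]
    simp only [aux_kron_vec]
    rfl
  have hIcc : ∀ {E : Type} [AddCommMonoid E] (T : ℕ) (g : ℕ → E),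
      ∑ t ∈ Finset.Icc 1 T, g t = ∑ t ∈ Finset.range T, g (t + 1) := by
    intro E _ T g
    rw [Finset.range_eq_Ico, Finset.sum_Ico_add' g 0 T 1]
    rfl
  intro f
  refine aux_main F η R hη hR0 hRm hηR h4 (1 + Cm) hC4
    (fun k => if k.1 = k.2 then (1:ℝ) else 0) M (fun t k => hcondcov t k.1 k.2) hM K B hB
    (fun T t ht p k => hKr _ (hmemT T t ht) p k)
    (fun T t ht => aux_kron_id _ _ (hnull _ (hmemT T t ht))) Om hOm hv
    (deltaStat G₁ G₂ ε) (fun T ω => ?_) (OmHatW G₁ G₂ ε) (fun T ω p q => ?_) f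
  · rw [deltaStat, hIcc]
    simp only [hθ]
  · simp only [OmHatW, hIcc, Matrix.smul_apply, Matrix.sum_apply, smul_eq_mul, ← hθ]
    congr 1
    refine Finset.sum_congr rfl fun t _ => ?_
    simp only [thetaSeq, kroneckerMap_apply, vecMulVec_apply]
    ring

end
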